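/- For every finite alphabet A, order k ≥ 0, initial state s0 ∈ A^k, and integer M ≥ 2, there exists a complete prefix-free dictionary D* ⊆ A^* such that for every n ≥ 1 and every type class T ∈ T_n: M divides |D*(T)| and |fail*_n(T)| = |T| mod M, where fail*_n is the failure set of D* at level n. Consequently, there is a map ξ : D* → {0,…,M−1} assigning, within each D*(T), the same number of sequences to each value, so that the resulting VFR and all of its truncations are universal in P_k. -/

import Mathlib

open Finset

/-- `Finset.filter` with classical decidability. -/
noncomputable def sfilter {α : Type*} (p : α → Prop) (s : Finset α) : Finset α :=
  @Finset.filter α p (Classical.decPred p) s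

/-- The finset of all strings of length `n` over the alphabet `A`. -/
def lists (A : Type*) [Fintype A] [DecidableEq A] : ℕ → Finset (List A)
  | 0 => {[]}
  | n + 1 => Finset.image₂ List.cons Finset.univ (lists A n)

/-- Symbol at (0-indexed) integer position `j` of the string `x`, where negative
positions `-k, …, -1` are given by the fixed initial state `s0`. -/
def symL {A : Type*} [Inhabited A] (k : ℕ) (s0 : Fin k → A) (x : List A) (j : ℤ) : A :=
  if h : 0 ≤ j then
    (if h2 : j.toNat < x.length then x.get ⟨j.toNat, h2⟩ else default)
  else
    (if h3 : (j + k).toNat < k then s0 ⟨(j + k).toNat, h3⟩ else default)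

/-- The state (context of order `k`) preceding position `t` of the string `x`. -/
def ctxL {A : Type*} [Inhabited A] (k : ℕ) (s0 : Fin k → A) (x : List A)
    (t : ℕ) : Fin k → A :=
  fun i => symL k s0 x ((t : ℤ) - (k : ℤ) + (i : ℤ))

/-- `n_{sa}(x)`: number of occurrences of symbol `a` in state `s` within `x`. -/
noncomputable def countL {A : Type*} [Inhabited A] [DecidableEq A] (k : ℕ)
    (s0 : Fin k → A) (s : Fin k → A) (a : A) (x : List A) : ℕ :=
  (sfilter (fun t : Fin x.length => ctxL k s0 x t = s ∧ x.get t = a) Finset.univ).card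

/-- Two strings have the same `k`-th order type. -/
def sameTypeL {A : Type*} [Inhabited A] [DecidableEq A] (k : ℕ) (s0 : Fin k → A)
    (x y : List A) : Prop :=
  x.length = y.length ∧
    ∀ (s : Fin k → A) (a : A), countL k s0 s a x = countL k s0 s a y

/-- The type class `T(x)` as a finset of strings of length `|x|`. -/
noncomputable def typeClassL {A : Type*} [Fintype A] [DecidableEq A] [Inhabited A]
    (k : ℕ) (s0 : Fin k → A) (x : List A) : Finset (List A) :=
  sfilter (fun y => sameTypeL k s0 x y) (lists A x.length)

/-- Probability `P(x) = ∏_t p(x_t | state)` of the string `x`. -/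
noncomputable def seqProbL {A : Type*} [Inhabited A] (k : ℕ) (s0 : Fin k → A)
    (p : (Fin k → A) → A → ℝ) (x : List A) : ℝ :=
  ∏ t : Fin x.length, p (ctxL k s0 x t) (x.get t)

/-- `p` is a (strictly positive) `k`-th order Markov kernel. -/
def IsMarkov {A : Type*} [Fintype A] (k : ℕ) (p : (Fin k → A) → A → ℝ) : Prop :=
  (∀ s a, 0 < p s a) ∧ ∀ s, ∑ a : A, p s a = 1

/-- A prefix-free set of strings. -/
def PrefixFree {A : Type*} (D : Set (List A)) : Prop :=
  ∀ x ∈ D, ∀ y ∈ D, x <+: y → x = y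

/-- A complete dictionary: prefix-free, and every string either has a prefix in `D`
or is a prefix of a string in `D`. -/
def CompleteDict {A : Type*} (D : Set (List A)) : Prop :=
  PrefixFree D ∧ ∀ z : List A, (∃ x ∈ D, x <+: z) ∨ (∃ y ∈ D, z <+: y)

/-- `D ∩ A^n` as a finset. -/
noncomputable def dictAt {A : Type*} [Fintype A] [DecidableEq A]
    (D : Set (List A)) (n : ℕ) : Finset (List A) :=
  sfilter (fun x => x ∈ D) (lists A n)

/-- The failure set at level `n`: strings of length `n` with no prefix in `D`. -/
noncomputable def failAt {A : Type*} [Fintype A] [DecidableEq A]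
    (D : Set (List A)) (n : ℕ) : Finset (List A) :=
  sfilter (fun x => ¬ ∃ y ∈ D, y <+: x) (lists A n)

/-- The failure part of a finite set `T` of strings: members with no prefix in `D`. -/
noncomputable def failIn {A : Type*} (D : Set (List A)) (T : Finset (List A)) :
    Finset (List A) :=
  sfilter (fun x => ¬ ∃ y ∈ D, y <+: x) T

/-- The VFR `(D, ξ, M)` is perfect for the process `p` (at every level `n`,
equivalently at every truncation level): conditioned on `X^n ∈ D ∩ A^n`
(whenever nonempty), `ξ(X^n)` is uniform on `{0, …, M−1}`. -/
def PerfectVFR {A : Type*} [Fintype A] [DecidableEq A] [Inhabited A] (k : ℕ)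
    (s0 : Fin k → A) (p : (Fin k → A) → A → ℝ) (D : Set (List A))
    (ξ : List A → ℕ) (M : ℕ) : Prop :=
  ∀ n : ℕ, (dictAt (A := A) D n).Nonempty →
    ∀ r < M,
      (∑ x ∈ sfilter (fun x => ξ x = r) (dictAt (A := A) D n), seqProbL k s0 p x)
        = (∑ x ∈ dictAt (A := A) D n, seqProbL k s0 p x) / (M : ℝ)

theorem sfilter_eq_filter {α : Type*} (p : α → Prop) [DecidablePred p] (s : Finset α) :
    sfilter p s = s.filter p := by
  unfold sfilter
  congr

@[simp]
theorem mem_sfilter {α : Type*} {p : α → Prop} {s : Finset α} {x : α} :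
    x ∈ sfilter p s ↔ x ∈ s ∧ p x := by
  simp [sfilter]

theorem dvd_card_of_dvd_card_fibers {α β : Type*} (S : Finset α) (f : α → β) (M : ℕ)
    (h : ∀ c, M ∣ (sfilter (fun x => f x = c) S).card) : M ∣ S.card := by
  classical
  rw [Finset.card_eq_sum_card_fiberwise (f := f) (t := S.image f)
    (fun x hx => Finset.mem_coe.2 (Finset.mem_image_of_mem f hx))]
  refine Finset.dvd_sum fun c _ => ?_
  rw [← sfilter_eq_filter]
  exact h c

theorem card_add_card_sfilter_not {α : Type*} (p : α → Prop) (S : Finset α) :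
    (sfilter p S).card + (sfilter (fun x => ¬ p x) S).card = S.card := by
  classical
  rw [sfilter_eq_filter, sfilter_eq_filter]
  exact Finset.card_filter_add_card_filter_not p

theorem exists_subset_card_fiber_eq {α β : Type*} (f : α → β) (M : ℕ) (S : Finset α) :
    ∃ S' ⊆ S, ∀ c, (sfilter (fun x => f x = c) S').card =
      M * ((sfilter (fun x => f x = c) S).card / M) := by
  classical
  choose K hK hcard using fun c => Finset.exists_subset_card_eq
    (Nat.mul_div_le (sfilter (fun x => f x = c) S).card M)
  refine ⟨sfilter (fun x => x ∈ K (f x)) S, fun x hx => (mem_sfilter.1 hx).1, fun c => ?_⟩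
  rw [← hcard c]
  congr 1
  ext x
  simp only [mem_sfilter]
  constructor
  · rintro ⟨⟨-, h⟩, rfl⟩
    exact h
  · intro h
    obtain ⟨h₁, rfl⟩ := mem_sfilter.1 (hK c h)
    exact ⟨⟨h₁, h⟩, rfl⟩

theorem exists_balanced_labeling {α : Type*} {M : ℕ} (hM : 0 < M) (K : Finset α)
    (hK : M ∣ K.card) :
    ∃ ξ : α → ℕ, (∀ x, ξ x < M) ∧
      ∀ r < M, M * (sfilter (fun x => ξ x = r) K).card = K.card := by
  classical
  obtain ⟨q, hq⟩ := hK
  have e : K ≃ Fin M × Fin q := Fintype.equivOfCardEq (by simp [hq])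
  refine ⟨fun x => if h : x ∈ K then (e ⟨x, h⟩).1 else 0, fun x => ?_, fun r hr => ?_⟩
  · dsimp only
    split_ifs
    · exact Fin.is_lt _
    · exact hM
  · rw [hq]
    congr 1
    refine Eq.trans (Eq.symm ?_) (Finset.card_fin q)
    refine Finset.card_bij (fun j _ => (e.symm (⟨r, hr⟩, j) : α)) ?_ ?_ ?_
    · intro j _
      simp
    · intro i _ j _ h
      simpa using h
    · intro x hx
      obtain ⟨hx, hr'⟩ := mem_sfilter.1 hx
      simp only [dif_pos hx] at hr'
      refine ⟨(e ⟨x, hx⟩).2, Finset.mem_univ _, ?_⟩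
      have : ((⟨r, hr⟩ : Fin M), (e ⟨x, hx⟩).2) = e ⟨x, hx⟩ := by
        ext <;> simp [hr']
      simp [this]

/-- From each fiber of `f` in `S`, a largest possible number of elements divisible by `M`. -/
noncomputable def greedyPick {α β : Type*} (f : α → β) (M : ℕ) (S : Finset α) : Finset α :=
  (exists_subset_card_fiber_eq f M S).choose

theorem greedyPick_subset {α β : Type*} (f : α → β) (M : ℕ) (S : Finset α) : greedyPick f M S ⊆ S :=
  (exists_subset_card_fiber_eq f M S).choose_spec.1

theorem card_greedyPick {α β : Type*} (f : α → β) (M : ℕ) (S : Finset α) (c : β) :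
    (sfilter (fun x => f x = c) (greedyPick f M S)).card =
      M * ((sfilter (fun x => f x = c) S).card / M) :=
  (exists_subset_card_fiber_eq f M S).choose_spec.2 c

section Greedy

variable {A : Type*} [Fintype A] [DecidableEq A]

@[simp]
theorem mem_lists {n : ℕ} {x : List A} : x ∈ lists A n ↔ x.length = n := by
  induction n generalizing x with
  | zero => simp [lists]
  | succ n ih =>
    cases x with
    | nil => simp [lists]
    | cons a x => simp [lists, ih]

theorem card_lists (n : ℕ) : (lists A n).card = Fintype.card A ^ n := by
  induction n with
  | zero => simp [lists]
  | succ n ih =>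
    rw [lists, Finset.card_image₂ (fun a b c d h => by simpa using h), ih, Finset.card_univ,
      pow_succ']

/-- All one-letter extensions of the strings in `F`. -/
def snocExtend (F : Finset (List A)) : Finset (List A) :=
  Finset.image₂ (fun w b => w ++ [b]) F Finset.univ

@[simp]
theorem snoc_mem_snocExtend {F : Finset (List A)} {w : List A} {b : A} :
    w ++ [b] ∈ snocExtend F ↔ w ∈ F := by
  simp [snocExtend]

theorem exists_snoc_of_mem_snocExtend {F : Finset (List A)} {x : List A}
    (hx : x ∈ snocExtend F) : ∃ w ∈ F, ∃ b, x = w ++ [b] := by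
  simp only [snocExtend, Finset.mem_image₂, Finset.mem_univ, true_and] at hx
  obtain ⟨w, hw, b, rfl⟩ := hx
  exact ⟨w, hw, b, rfl⟩

variable {C : Type*} (τ : List A → C) (M : ℕ)

/-- The strings of length `n` that the greedy procedure leaves unassigned. -/
noncomputable def greedyFail : ℕ → Finset (List A)
  | 0 => {[]}
  | n + 1 => snocExtend (greedyFail n) \ greedyPick τ M (snocExtend (greedyFail n))

/-- The greedy dictionary. -/
def greedyDict : Set (List A) :=
  {x | ∃ n, x ∈ greedyPick τ M (snocExtend (greedyFail τ M n))}

theorem greedyFail_subset_lists (n : ℕ) : greedyFail τ M n ⊆ lists A n := by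
  induction n with
  | zero => simp [greedyFail, lists]
  | succ n ih =>
    intro x hx
    obtain ⟨w, hw, b, rfl⟩ := exists_snoc_of_mem_snocExtend (Finset.mem_sdiff.1 hx).1
    have := mem_lists.1 (ih hw)
    simp [this]

theorem snocExtend_greedyFail_subset_lists (n : ℕ) :
    snocExtend (greedyFail τ M n) ⊆ lists A (n + 1) := by
  intro x hx
  obtain ⟨w, hw, b, rfl⟩ := exists_snoc_of_mem_snocExtend hx
  have := mem_lists.1 (greedyFail_subset_lists τ M n hw)
  simp [this]

theorem nil_notMem_greedyDict : [] ∉ greedyDict τ M := by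
  rintro ⟨n, hn⟩
  have := mem_lists.1 (snocExtend_greedyFail_subset_lists τ M n (greedyPick_subset τ M _ hn))
  simp at this

theorem mem_greedyDict_iff {n : ℕ} {x : List A} (hx : x.length = n + 1) :
    x ∈ greedyDict τ M ↔ x ∈ greedyPick τ M (snocExtend (greedyFail τ M n)) := by
  refine ⟨?_, fun h => ⟨n, h⟩⟩
  rintro ⟨m, hm⟩
  have := mem_lists.1 (snocExtend_greedyFail_subset_lists τ M m (greedyPick_subset τ M _ hm))
  obtain rfl : m = n := by omega
  exact hm

theorem mem_greedyFail_iff {n : ℕ} {x : List A} (hx : x.length = n) :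
    x ∈ greedyFail τ M n ↔ ¬ ∃ y ∈ greedyDict τ M, y <+: x := by
  induction n generalizing x with
  | zero =>
    obtain rfl := List.eq_nil_of_length_eq_zero hx
    simp [greedyFail, nil_notMem_greedyDict]
  | succ n ih =>
    obtain ⟨w, b, rfl⟩ := List.eq_nil_or_concat' x |>.resolve_left (by rintro rfl; simp at hx)
    have hw : w.length = n := by simpa using hx
    rw [greedyFail, Finset.mem_sdiff, snoc_mem_snocExtend, ih hw, ← mem_greedyDict_iff τ M hx]
    simp only [List.prefix_concat_iff]
    grind

theorem prefixFree_greedyDict : PrefixFree (greedyDict τ M) := by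
  intro x hx y hy hxy
  obtain ⟨n, hn⟩ := hy
  obtain ⟨w, hw, b, rfl⟩ := exists_snoc_of_mem_snocExtend (greedyPick_subset τ M _ hn)
  rcases List.prefix_concat_iff.1 hxy with h | h
  · exact h
  · exact absurd ⟨x, hx, h⟩
      ((mem_greedyFail_iff τ M (mem_lists.1 (greedyFail_subset_lists τ M n hw))).1 hw)

theorem dvd_card_notMem_greedyFail
    (hτ : ∀ x y : List A, x.length = y.length → τ x = τ y → ∀ b, τ (x ++ [b]) = τ (y ++ [b]))
    (n : ℕ) (c : C) :
    M ∣ (sfilter (fun x => τ x = c ∧ x ∉ greedyFail τ M n) (lists A n)).card ∧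
    M ∣ (sfilter (fun x => τ x = c ∧ x ∉ snocExtend (greedyFail τ M n)) (lists A (n + 1))).card := by
  classical
  have step : ∀ n, (∀ c, M ∣ (sfilter (fun x => τ x = c ∧ x ∉ greedyFail τ M n) (lists A n)).card) →
      ∀ c, M ∣ (sfilter (fun x => τ x = c ∧ x ∉ snocExtend (greedyFail τ M n))
        (lists A (n + 1))).card := by
    intro n ih c
    refine dvd_card_of_dvd_card_fibers _ (fun x => (τ x.dropLast, x.getLast?)) M ?_
    rintro ⟨c', b'⟩
    set S := sfilter (fun x => τ x = c ∧ x ∉ snocExtend (greedyFail τ M n)) (lists A (n + 1))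
    rcases (sfilter (fun x => (τ x.dropLast, x.getLast?) = (c', b')) S).eq_empty_or_nonempty
      with h | ⟨x, hx⟩
    · rw [h]
      simp
    · have hx' := hx
      simp only [S, mem_sfilter, mem_lists, Prod.mk.injEq] at hx'
      obtain ⟨⟨hlen, hc, -⟩, hc', hb'⟩ := hx'
      obtain ⟨w, b, rfl⟩ := List.eq_nil_or_concat' x |>.resolve_left (by rintro rfl; simp at hlen)
      simp only [List.dropLast_concat, List.getLast?_concat] at hc' hb'
      have hw : w.length = n := by simpa using hlen
      convert ih c' using 1
      symm
      refine Finset.card_bij (fun v _ => v ++ [b]) ?_ ?_ ?_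
      · intro v hv
        simp only [mem_sfilter, mem_lists] at hv
        simp only [S, mem_sfilter, mem_lists, Prod.mk.injEq, snoc_mem_snocExtend,
          List.dropLast_concat, List.getLast?_concat]
        exact ⟨⟨by simp [hv.1], (hτ v w (hv.1.trans hw.symm) (hv.2.1.trans hc'.symm) b).trans hc,
          hv.2.2⟩, hv.2.1, hb'⟩
      · intro u _ v _ h
        simpa using h
      · intro y hy
        simp only [S, mem_sfilter, mem_lists, Prod.mk.injEq] at hy
        obtain ⟨⟨hlen_y, -, hF⟩, hy', hb⟩ := hy
        obtain ⟨v, a, rfl⟩ := List.eq_nil_or_concat' y |>.resolve_left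
          (by rintro rfl; simp at hlen_y)
        simp only [List.dropLast_concat, List.getLast?_concat] at hy' hb
        obtain rfl : a = b := by simpa using hb.trans hb'.symm
        rw [snoc_mem_snocExtend] at hF
        exact ⟨v, by simpa [hy', hF] using hlen_y, rfl⟩
  have main : ∀ n c, M ∣ (sfilter (fun x => τ x = c ∧ x ∉ greedyFail τ M n) (lists A n)).card := by
    intro n
    induction n with
    | zero =>
      intro c
      have : sfilter (fun x => τ x = c ∧ x ∉ greedyFail τ M 0) (lists A 0) = ∅ := by
        ext x
        simp +contextual [greedyFail]
      simp [this]
    | succ n ih =>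
      intro c
      have hpick := card_greedyPick τ M (snocExtend (greedyFail τ M n)) c
      have key : sfilter (fun x => τ x = c ∧ x ∉ greedyFail τ M (n + 1)) (lists A (n + 1)) =
          sfilter (fun x => τ x = c ∧ x ∉ snocExtend (greedyFail τ M n)) (lists A (n + 1)) ∪
          sfilter (fun x => τ x = c) (greedyPick τ M (snocExtend (greedyFail τ M n))) := by
        ext x
        have h₁ := @greedyPick_subset _ _ τ M (snocExtend (greedyFail τ M n)) x
        have h₂ := @snocExtend_greedyFail_subset_lists _ _ _ _ τ M n x
        simp only [greedyFail, mem_sfilter, Finset.mem_union, Finset.mem_sdiff]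
        tauto
      rw [key, Finset.card_union_of_disjoint, hpick]
      · exact dvd_add (step n ih c) (dvd_mul_right _ _)
      · rw [Finset.disjoint_left]
        intro x hx hx'
        simp only [mem_sfilter] at hx hx'
        exact hx.2.2 (greedyPick_subset τ M _ hx'.1)
  exact ⟨main n c, step n (main n) c⟩

theorem card_greedyFail
    (hτ : ∀ x y : List A, x.length = y.length → τ x = τ y → ∀ b, τ (x ++ [b]) = τ (y ++ [b]))
    (n : ℕ) (c : C) :
    (sfilter (fun x => τ x = c) (greedyFail τ M (n + 1))).card =
      (sfilter (fun x => τ x = c) (lists A (n + 1))).card % M := by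
  classical
  set E := snocExtend (greedyFail τ M n)
  have h₁ : (sfilter (fun x => τ x = c) (lists A (n + 1))).card =
      (sfilter (fun x => τ x = c) E).card +
      (sfilter (fun x => τ x = c ∧ x ∉ E) (lists A (n + 1))).card := by
    rw [← card_add_card_sfilter_not (· ∈ E)]
    congr 2
    · ext x
      have := @snocExtend_greedyFail_subset_lists _ _ _ _ τ M n x
      simp only [mem_sfilter]
      tauto
    · ext x
      simp only [mem_sfilter]
      tauto
  have h₂ : (sfilter (fun x => τ x = c) E).card =
      (sfilter (fun x => τ x = c) (greedyPick τ M E)).card +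
      (sfilter (fun x => τ x = c) (greedyFail τ M (n + 1))).card := by
    rw [← card_add_card_sfilter_not (· ∈ greedyPick τ M E)]
    congr 2
    · ext x
      have := @greedyPick_subset _ _ τ M E x
      simp only [mem_sfilter]
      tauto
    · ext x
      simp only [greedyFail, mem_sfilter, Finset.mem_sdiff]
      tauto
  rw [card_greedyPick] at h₂
  obtain ⟨q, hq⟩ := (dvd_card_notMem_greedyFail τ M hτ n c).2
  rw [h₁, hq, Nat.add_mul_mod_self_left]
  have := Nat.div_add_mod (sfilter (fun x => τ x = c) E).card M
  omega

theorem completeDict_greedyDict (hM : 0 < M) (hA : 2 ≤ Fintype.card A)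
    (hτ : ∀ x y : List A, x.length = y.length → τ x = τ y → ∀ b, τ (x ++ [b]) = τ (y ++ [b]))
    (K : ℕ) (hK : ∀ n, ((τ '' {x | x.length = n}).Finite ∧
      (τ '' {x | x.length = n}).ncard ≤ (n + 1) ^ K)) :
    CompleteDict (greedyDict τ M) := by
  classical
  refine ⟨prefixFree_greedyDict τ M, fun z => ?_⟩
  by_contra! hz
  obtain ⟨hz₁, hz₂⟩ := hz
  have bound : ∀ m, Fintype.card A ^ m ≤ M * (z.length + m + 1 + 1) ^ K := by
    intro m
    obtain ⟨hfin, hcard⟩ := hK (z.length + m + 1)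
    have h₁ : Fintype.card A ^ (m + 1) ≤ (greedyFail τ M (z.length + m + 1)).card := by
      rw [← card_lists]
      refine Finset.card_le_card_of_injOn (z ++ ·) ?_ ?_
      · intro v hv
        have hv : v.length = m + 1 := mem_lists.1 hv
        rw [Finset.mem_coe, mem_greedyFail_iff _ _ (by simp [hv, add_assoc])]
        rintro ⟨y, hy, hyz⟩
        rcases List.prefix_or_prefix_of_prefix hyz (List.prefix_append z v) with h | h
        · exact hz₁ y hy h
        · exact hz₂ y hy h
      · intro u _ v _ h
        simpa using h
    have h₂ : (greedyFail τ M (z.length + m + 1)).card ≤ M * hfin.toFinset.card := by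
      refine Finset.card_le_mul_card_image_of_maps_to (f := τ) ?_ M ?_
      · intro x hx
        simpa using ⟨x, mem_lists.1 (greedyFail_subset_lists τ M _ hx), rfl⟩
      · intro c _
        rw [← sfilter_eq_filter, card_greedyFail τ M hτ]
        exact (Nat.mod_lt _ hM).le
    rw [← Set.ncard_eq_toFinset_card _ hfin] at h₂
    calc Fintype.card A ^ m ≤ Fintype.card A ^ (m + 1) := Nat.pow_le_pow_right (by omega) (by omega)
      _ ≤ _ := h₁.trans (h₂.trans (Nat.mul_le_mul_left M hcard))
  have hlim := tendsto_pow_const_div_const_pow_of_one_lt K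
    (show (1 : ℝ) < Fintype.card A by exact_mod_cast hA)
  have hpos : (0 : ℝ) < Fintype.card A := by exact_mod_cast (by omega : 0 < Fintype.card A)
  have hMpos : (0 : ℝ) < M := by exact_mod_cast hM
  set N := z.length + 2
  obtain ⟨n, hn, hnN⟩ := ((hlim.eventually_lt_const
    (show (0 : ℝ) < 1 / (M * (Fintype.card A : ℝ) ^ N) by positivity)).and
      (Filter.eventually_ge_atTop N)).exists
  obtain ⟨m, rfl⟩ := Nat.exists_eq_add_of_le hnN
  have hb : (Fintype.card A : ℝ) ^ m ≤ M * ((N + m : ℕ) : ℝ) ^ K := by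
    have := bound m
    rw [show z.length + m + 1 + 1 = N + m by omega] at this
    exact_mod_cast this
  rw [div_lt_div_iff₀ (by positivity) (by positivity), one_mul, pow_add _ N m] at hn
  have hN : (0 : ℝ) < (Fintype.card A : ℝ) ^ N := by positivity
  nlinarith [mul_le_mul_of_nonneg_left hb hN.le]

end Greedy

section Types

variable {A : Type*} [Inhabited A] (k : ℕ) (s0 : Fin k → A)

theorem symL_snoc_of_lt (x : List A) (b : A) {j : ℤ} (hj : j < x.length) :
    symL k s0 (x ++ [b]) j = symL k s0 x j := by
  unfold symL
  split_ifs with h₀ h₁ h₂ h₃ <;> simp at * <;> grind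

theorem symL_natCast (x : List A) (t : ℕ) (ht : t < x.length) : symL k s0 x t = x[t] := by
  simp [symL, ht]

theorem ctxL_snoc_of_le (x : List A) (b : A) {t : ℕ} (ht : t ≤ x.length) :
    ctxL k s0 (x ++ [b]) t = ctxL k s0 x t := by
  funext i
  exact symL_snoc_of_lt k s0 x b (by have := i.2; omega)

/-- The state reached after reading `b` in state `s`. -/
def nextState {A : Type*} {k : ℕ} (s : Fin k → A) (b : A) : Fin k → A :=
  fun i => if h : (i : ℕ) + 1 < k then s ⟨i + 1, h⟩ else b

theorem ctxL_snoc_length (x : List A) (b : A) :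
    ctxL k s0 (x ++ [b]) (x ++ [b]).length = nextState (ctxL k s0 x x.length) b := by
  funext i
  unfold nextState ctxL
  have hi := i.2
  split_ifs with h
  · rw [symL_snoc_of_lt k s0 x b (by simp; omega)]
    congr 1
    simp
    ring
  · rw [show ((x ++ [b]).length : ℤ) - k + (i : ℕ) = (x.length : ℕ) by simp; omega,
      symL_natCast _ _ _ _ (by simp)]
    simp

variable [DecidableEq A]

theorem countL_eq_card_range (s : Fin k → A) (a : A) (x : List A) :
    countL k s0 s a x = (sfilter (fun t : ℕ => ctxL k s0 x t = s ∧ symL k s0 x t = a)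
      (Finset.range x.length)).card := by
  refine Finset.card_bij (fun t _ => (t : ℕ)) ?_ ?_ ?_
  · intro t ht
    simpa [symL_natCast] using ht
  · intro t _ u _ h
    exact Fin.ext h
  · intro t ht
    simp only [mem_sfilter, Finset.mem_range] at ht
    refine ⟨⟨t, ht.1⟩, ?_, rfl⟩
    simpa [symL_natCast _ _ _ _ ht.1] using ht.2

theorem countL_le_length (s : Fin k → A) (a : A) (x : List A) :
    countL k s0 s a x ≤ x.length := by
  rw [countL_eq_card_range]
  calc _ ≤ (Finset.range x.length).card :=
        Finset.card_le_card fun t ht => (mem_sfilter.1 ht).1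
    _ = _ := Finset.card_range _

theorem countL_snoc (s : Fin k → A) (a : A) (x : List A) (b : A) :
    countL k s0 s a (x ++ [b]) =
      countL k s0 s a x + if ctxL k s0 x x.length = s ∧ b = a then 1 else 0 := by
  classical
  rw [countL_eq_card_range, countL_eq_card_range, sfilter_eq_filter, sfilter_eq_filter,
    Finset.card_filter, Finset.card_filter, List.length_append, List.length_singleton,
    Finset.sum_range_succ]
  congr 1
  · refine Finset.sum_congr rfl fun t ht => ?_
    have ht := Finset.mem_range.1 ht
    rw [ctxL_snoc_of_le k s0 x b ht.le, symL_snoc_of_lt k s0 x b (by exact_mod_cast ht)]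
  · rw [ctxL_snoc_of_le k s0 x b le_rfl, symL_natCast _ _ _ _ (by simp)]
    simp

variable [Fintype A]

/-- Flow conservation: visits to `s` counted by departures agree with those counted by arrivals. -/
theorem sum_countL_add_final (s : Fin k → A) (x : List A) :
    ∑ a, countL k s0 s a x + (if ctxL k s0 x x.length = s then 1 else 0) =
      (if ctxL k s0 [] 0 = s then 1 else 0) +
        ∑ q : (Fin k → A) × A, if nextState q.1 q.2 = s then countL k s0 q.1 q.2 x else 0 := by
  induction x using List.reverseRecOn with
  | nil =>
    have h : ∀ s a, countL k s0 s a ([] : List A) = 0 := fun s a =>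
      Nat.le_zero.1 (countL_le_length k s0 s a [])
    simp [h]
  | append_singleton x b ih =>
    have h₁ : ∑ a, countL k s0 s a (x ++ [b]) =
        ∑ a, countL k s0 s a x + (if ctxL k s0 x x.length = s then 1 else 0) := by
      simp only [countL_snoc, Finset.sum_add_distrib]
      congr 1
      by_cases h : ctxL k s0 x x.length = s <;> simp [h]
    have h₂ : (∑ q : (Fin k → A) × A,
          if nextState q.1 q.2 = s then countL k s0 q.1 q.2 (x ++ [b]) else 0) =
        (∑ q : (Fin k → A) × A, if nextState q.1 q.2 = s then countL k s0 q.1 q.2 x else 0) +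
          if nextState (ctxL k s0 x x.length) b = s then 1 else 0 := by
      rw [← Finset.sum_ite_eq Finset.univ (ctxL k s0 x x.length, b)
          (fun q : (Fin k → A) × A => if nextState q.1 q.2 = s then 1 else 0)
        |>.trans (if_pos (Finset.mem_univ _)), ← Finset.sum_add_distrib]
      refine Finset.sum_congr rfl fun q _ => ?_
      rw [countL_snoc]
      obtain ⟨s', a⟩ := q
      simp only [Prod.mk.injEq]
      split_ifs <;> simp
    rw [h₁, h₂, ih, ctxL_snoc_length]
    ring

/-- The `k`-th order type of a string, as the table of its transition counts. -/
noncomputable def typeOf (x : List A) : (Fin k → A) → A → ℕ :=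
  fun s a => countL k s0 s a x

theorem ctxL_length_eq_of_typeOf_eq {x y : List A} (h : typeOf k s0 x = typeOf k s0 y) :
    ctxL k s0 x x.length = ctxL k s0 y y.length := by
  have hc : ∀ s a, countL k s0 s a x = countL k s0 s a y := fun s a => congrFun₂ h s a
  have hx := sum_countL_add_final k s0 (ctxL k s0 x x.length) x
  have hy := sum_countL_add_final k s0 (ctxL k s0 x x.length) y
  simp only [hc, if_true] at hx
  by_contra hne
  rw [if_neg (Ne.symm hne)] at hy
  omega

theorem typeOf_snoc_eq {x y : List A} (h : typeOf k s0 x = typeOf k s0 y) (b : A) :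
    typeOf k s0 (x ++ [b]) = typeOf k s0 (y ++ [b]) := by
  funext s a
  simp only [typeOf, countL_snoc, ctxL_length_eq_of_typeOf_eq k s0 h]
  rw [show countL k s0 s a x = countL k s0 s a y from congrFun₂ h s a]

theorem typeOf_image_finite_and_ncard_le (n : ℕ) :
    (typeOf k s0 '' {x | x.length = n}).Finite ∧
      (typeOf k s0 '' {x | x.length = n}).ncard ≤
        (n + 1) ^ (Fintype.card A * Fintype.card (Fin k → A)) := by
  classical
  have hsub : typeOf k s0 '' {x | x.length = n} ⊆
      (Fintype.piFinset fun _ : Fin k → A => Fintype.piFinset fun _ : A => Finset.range (n + 1) :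
        Finset ((Fin k → A) → A → ℕ)) := by
    rintro _ ⟨x, rfl, rfl⟩
    simpa [Nat.lt_succ_iff, typeOf] using fun s a => countL_le_length k s0 s a x
  refine ⟨(Finset.finite_toSet _).subset hsub, ?_⟩
  refine (Set.ncard_le_ncard hsub (Finset.finite_toSet _)).trans ?_
  rw [Set.ncard_coe_finset]
  simp [Fintype.card_piFinset, pow_mul]

theorem typeClassL_eq (x : List A) :
    typeClassL k s0 x = sfilter (fun y => typeOf k s0 y = typeOf k s0 x) (lists A x.length) := by
  ext y
  simp only [typeClassL, mem_sfilter, mem_lists, sameTypeL]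
  constructor
  · rintro ⟨h, -, h'⟩
    exact ⟨h, funext₂ fun s a => (h' s a).symm⟩
  · rintro ⟨h, h'⟩
    exact ⟨h, h.symm, fun s a => (congrFun₂ h' s a).symm⟩

theorem seqProbL_eq_prod_typeOf (p : (Fin k → A) → A → ℝ) (x : List A) :
    seqProbL k s0 p x = ∏ q : (Fin k → A) × A, p q.1 q.2 ^ typeOf k s0 x q.1 q.2 := by
  classical
  unfold seqProbL
  rw [← Finset.prod_fiberwise Finset.univ
    (fun t : Fin x.length => (ctxL k s0 x t, x.get t))]
  refine Finset.prod_congr rfl fun q _ => ?_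
  rw [typeOf, countL, sfilter_eq_filter, ← Finset.prod_const]
  refine Finset.prod_congr (by ext t; simp [Prod.ext_iff]) fun t ht => ?_
  simp only [Finset.mem_filter] at ht
  rw [← ht.2.1, ← ht.2.2]

end Types

/-- A labeling balanced on every fiber of a sufficient statistic is balanced in measure. -/
theorem sum_sfilter_eq_sum_div_of_balanced {α C : Type*} (S : Finset α) (τ : α → C) (P : C → ℝ)
    (ξ : α → ℕ) (M r : ℕ) (hM : 0 < M)
    (h : ∀ c, M * (sfilter (fun x => τ x = c ∧ ξ x = r) S).card =
      (sfilter (fun x => τ x = c) S).card) :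
    ∑ x ∈ sfilter (fun x => ξ x = r) S, P (τ x) = (∑ x ∈ S, P (τ x)) / M := by
  classical
  have hM' : (M : ℝ) ≠ 0 := by exact_mod_cast hM.ne'
  rw [eq_div_iff hM', ← Finset.sum_fiberwise_of_maps_to (s := S) (t := S.image τ)
      (fun x hx => Finset.mem_image_of_mem τ hx),
    ← Finset.sum_fiberwise_of_maps_to (s := sfilter (fun x => ξ x = r) S) (t := S.image τ)
      (fun x hx => Finset.mem_image_of_mem τ (mem_sfilter.1 hx).1), Finset.sum_mul]
  refine Finset.sum_congr rfl fun c _ => ?_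
  have hconst : ∀ U : Finset α, ∑ x ∈ U with τ x = c, P (τ x) =
      (sfilter (fun x => τ x = c) U).card * P c := by
    intro U
    rw [sfilter_eq_filter, ← nsmul_eq_mul, ← Finset.sum_const]
    exact Finset.sum_congr rfl fun x hx => by rw [(Finset.mem_filter.1 hx).2]
  have hinter : sfilter (fun x => τ x = c) (sfilter (fun x => ξ x = r) S) =
      sfilter (fun x => τ x = c ∧ ξ x = r) S := by
    ext x
    simp only [mem_sfilter]
    tauto
  rw [hconst, hconst, hinter, ← h c]
  push_cast
  ring

/-- Existence of the greedy dictionary `D*`: a complete prefix-free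
dictionary such that for every level `n` and every type class `T`, `M` divides
`|D*(T)|` and `|fail*_n(T)| = |T| mod M`; together with a balanced labeling `ξ`,
it yields a VFR all of whose truncations are universal in `P_k`. -/
theorem greedy_dictionary_exists {A : Type*} [Fintype A] [DecidableEq A] [Inhabited A]
    (hA : 2 ≤ Fintype.card A) (k : ℕ) (s0 : Fin k → A) (M : ℕ) (hM : 2 ≤ M) :
    ∃ D : Set (List A),
      CompleteDict D ∧
      (∀ n : ℕ, 1 ≤ n → ∀ x ∈ lists A n,
        M ∣ (sfilter (fun y => y ∈ D) (typeClassL k s0 x)).card ∧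
        (failIn D (typeClassL k s0 x)).card = (typeClassL k s0 x).card % M) ∧
      ∃ ξ : List A → ℕ,
        (∀ x ∈ D, ξ x < M) ∧
        (∀ n : ℕ, 1 ≤ n → ∀ x ∈ lists A n, ∀ r < M, ∀ r' < M,
          (sfilter (fun y => y ∈ D ∧ ξ y = r) (typeClassL k s0 x)).card =
          (sfilter (fun y => y ∈ D ∧ ξ y = r') (typeClassL k s0 x)).card) ∧
        (∀ p : (Fin k → A) → A → ℝ, IsMarkov k p → PerfectVFR k s0 p D ξ M) := by
  classical
  have hM0 : 0 < M := by omega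
  set τ := typeOf k s0
  have hτ : ∀ x y : List A, x.length = y.length → τ x = τ y →
      ∀ b, τ (x ++ [b]) = τ (y ++ [b]) := fun x y _ h b => typeOf_snoc_eq k s0 h b
  set D := greedyDict τ M
  let L : ℕ → ((Fin k → A) → A → ℕ) → Finset (List A) :=
    fun n c => sfilter (fun y => τ y = c ∧ y ∈ D) (lists A n)
  have hdvd : ∀ n c, M ∣ (L n c).card := by
    intro n c
    cases n with
    | zero =>
      have : L 0 c = ∅ := by
        ext y
        simp only [L, mem_sfilter, mem_lists, List.length_eq_zero_iff]
        constructor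
        · rintro ⟨rfl, -, h⟩
          exact absurd h (nil_notMem_greedyDict τ M)
        · simp
      simp [this]
    | succ n =>
      have : L (n + 1) c = sfilter (fun y => τ y = c)
          (greedyPick τ M (snocExtend (greedyFail τ M n))) := by
        ext y
        simp only [L, mem_sfilter, mem_lists]
        constructor
        · rintro ⟨h, h', hy⟩
          exact ⟨(mem_greedyDict_iff τ M h).1 hy, h'⟩
        · rintro ⟨hy, h'⟩
          exact ⟨mem_lists.1 (snocExtend_greedyFail_subset_lists τ M n
            (greedyPick_subset τ M _ hy)), h', ⟨n, hy⟩⟩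
      rw [this, card_greedyPick]
      exact dvd_mul_right _ _
  choose label hlabel_lt hlabel using fun n c => exists_balanced_labeling hM0 (L n c) (hdvd n c)
  let ξ : List A → ℕ := fun x => label x.length (τ x) x
  have hξ : ∀ n c, ∀ r < M,
      M * (sfilter (fun y => ξ y = r) (L n c)).card = (L n c).card := by
    intro n c r hr
    rw [← hlabel n c r hr]
    congr 2
    ext y
    simp only [L, ξ, mem_sfilter, mem_lists]
    constructor
    · rintro ⟨⟨rfl, rfl, h⟩, h'⟩
      exact ⟨⟨rfl, rfl, h⟩, h'⟩
    · rintro ⟨⟨rfl, rfl, h⟩, h'⟩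
      exact ⟨⟨rfl, rfl, h⟩, h'⟩
  refine ⟨D, completeDict_greedyDict τ M hM0 hA hτ _ (typeOf_image_finite_and_ncard_le k s0), ?_,
    ξ, fun x _ => hlabel_lt _ _ _, ?_, ?_⟩
  · intro n hn x hx
    obtain ⟨n, rfl⟩ := Nat.exists_eq_add_of_le' hn
    have hx := mem_lists.1 hx
    rw [typeClassL_eq, hx]
    constructor
    · convert hdvd (n + 1) (τ x) using 2
      ext y
      simp only [L, mem_sfilter]
      tauto
    · rw [← card_greedyFail τ M hτ]
      congr 1
      ext y
      simp only [failIn, mem_sfilter]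
      constructor
      · rintro ⟨⟨hy, h⟩, h'⟩
        exact ⟨(mem_greedyFail_iff τ M (mem_lists.1 hy)).2 h', h⟩
      · rintro ⟨hy, h⟩
        have hy' := greedyFail_subset_lists τ M _ hy
        exact ⟨⟨hy', h⟩, (mem_greedyFail_iff τ M (mem_lists.1 hy')).1 hy⟩
  · intro n _ x _ r hr r' hr'
    have key : ∀ r, sfilter (fun y => y ∈ D ∧ ξ y = r) (typeClassL k s0 x) =
        sfilter (fun y => ξ y = r) (L x.length (τ x)) := by
      intro r
      rw [typeClassL_eq]
      ext y
      simp only [L, mem_sfilter]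
      tauto
    rw [key, key]
    exact Nat.eq_of_mul_eq_mul_left hM0 ((hξ _ _ r hr).trans (hξ _ _ r' hr').symm)
  · intro p _ n _ r hr
    simp only [seqProbL_eq_prod_typeOf]
    refine sum_sfilter_eq_sum_div_of_balanced (dictAt D n) τ
      (fun c => ∏ q : (Fin k → A) × A, p q.1 q.2 ^ c q.1 q.2) ξ M r hM0 fun c => ?_
    convert hξ n c r hr using 2
    · congr 1
      ext y
      simp only [L, dictAt, mem_sfilter]
      tauto
    · ext y
      simp only [L, dictAt, mem_sfilter]
      tauto
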